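/- arXiv:2302.05909 — 2 statements merged into one kernel-verified Lean document; each statement's English description precedes it below -/
import Mathlib

section
/- Any special involutive commutative two-valued group that does not contain single-valued direct factors is isomorphic to a two-valued group Y_V, where V is a Boolean group with dim V ≥ 2. -/
/-!
Two-valued groups after V.M. Buchstaber, A.P. Veselov and A.A. Gaifullin.

`X.mul x y` is the two-element multiset `x * y`.
-/

universe u v w u' v' w'

/-- A two-valued group: a set with a multiplication valued in two-element multisets,
a strong identity `e`, and a (unique) inverse. -/
structure TwoValuedGroup (T : Type u) where
  mul : T → T → Multiset T
  e : T
  inv : T → T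
  card_mul : ∀ x y, Multiset.card (mul x y) = 2
  assoc : ∀ x y z, (mul x y).bind (fun t => mul t z) = (mul y z).bind (fun t => mul x t)
  e_mul : ∀ x, mul e x = {x, x}
  mul_e : ∀ x, mul x e = {x, x}
  e_mem_mul_inv : ∀ x, e ∈ mul x (inv x)
  e_mem_inv_mul : ∀ x, e ∈ mul (inv x) x
  inv_unique : ∀ x y, (e ∈ mul x y ∨ e ∈ mul y x) → y = inv x

namespace TwoValuedGroup

/-- Commutativity of a two-valued group. -/
def Commutative {T : Type u} (X : TwoValuedGroup T) : Prop := ∀ x y, X.mul x y = X.mul y x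

/-- Involutivity: every element is its own inverse. -/
def Involutive {T : Type u} (X : TwoValuedGroup T) : Prop := ∀ x, X.inv x = x

/-- A homomorphism of two-valued groups. -/
def IsHom {T : Type u} {S : Type v} (X : TwoValuedGroup T) (Z : TwoValuedGroup S)
    (f : T → S) : Prop :=
  f X.e = Z.e ∧ ∀ x y, (X.mul x y).map f = Z.mul (f x) (f y)

/-- Two two-valued groups are isomorphic if there is a bijective homomorphism. -/
def Isomorphic {T : Type u} {S : Type v} (X : TwoValuedGroup T) (Z : TwoValuedGroup S) : Prop :=
  ∃ f : T → S, Function.Bijective f ∧ IsHom X Z f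

/-- A subgroup of a two-valued group: a subset closed under multiplication. -/
def IsSubgroup {T : Type u} (X : TwoValuedGroup T) (Y : Set T) : Prop :=
  ∀ y₁ ∈ Y, ∀ y₂ ∈ Y, ∀ z ∈ X.mul y₁ y₂, z ∈ Y

/-- `S` generates `X` if the only subgroup of `X` containing `S` is all of `X`. -/
def Generates {T : Type u} (X : TwoValuedGroup T) (S : Set T) : Prop :=
  ∀ Y : Set T, X.IsSubgroup Y → S ⊆ Y → Y = Set.univ

/-- Finitely generated two-valued group. -/
def FinitelyGenerated {T : Type u} (X : TwoValuedGroup T) : Prop :=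
  ∃ S : Set T, S.Finite ∧ X.Generates S

/-- A family of integer power sequences: `P x k` is the `k`-th power `x^k` of `x`;
these are uniquely determined in an involutive two-valued group. -/
def IsPowFamily {T : Type u} (X : TwoValuedGroup T) (P : T → ℤ → T) : Prop :=
  ∀ x : T, P x 0 = X.e ∧ P x 1 = x ∧ (∀ k : ℤ, P x (-k) = P x k) ∧
    ∀ k : ℤ, 1 ≤ k → X.mul x (P x k) = {P x (k - 1), P x (k + 1)}

/-- The order of an element: the least positive `k` with `x^k = e`;
the value `0` encodes infinite order. -/
noncomputable def ordOf {T : Type u} (X : TwoValuedGroup T) (P : T → ℤ → T) (x : T) : ℕ :=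
  sInf {n : ℕ | 0 < n ∧ P x (n : ℤ) = X.e}

/-- `ord x > 2` (where infinite order counts as `> 2`). -/
def OrdGT2 {T : Type u} (X : TwoValuedGroup T) (P : T → ℤ → T) (x : T) : Prop :=
  X.ordOf P x = 0 ∨ 2 < X.ordOf P x

/-- A two-valued group is special if it contains a special pair: `ord x > 2`, `ord y > 2`,
and `x * y` consists of two equal elements. -/
def IsSpecial {T : Type u} (X : TwoValuedGroup T) (P : T → ℤ → T) : Prop :=
  ∃ x y z : T, X.OrdGT2 P x ∧ X.OrdGT2 P y ∧ X.mul x y = {z, z}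

/-- `ι` is an involutive automorphism of the group `G`. -/
def IsInvolutiveAut (G : Type v) [Group G] (ι : G → G) : Prop :=
  Function.Bijective ι ∧ (∀ g h : G, ι (g * h) = ι g * ι h) ∧ (∀ g : G, ι (ι g) = g)

/-- `X` is isomorphic to the coset two-valued group `G/ι`: there is a quotient map
`π : G → X` whose fibres are exactly the `ι`-orbits and which carries the coset
two-valued multiplication `π g * π h = [π (g h), π (g ι(h))]`. -/
def IsCosetOf {T : Type u} {G : Type v} [Group G] (X : TwoValuedGroup T) (ι : G → G) : Prop :=
  ∃ π : G → T, Function.Surjective π ∧ π 1 = X.e ∧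
    (∀ g, π (ι g) = π g) ∧
    (∀ g h, π g = π h → h = g ∨ h = ι g) ∧
    (∀ g h, X.mul (π g) (π h) = {π (g * h), π (g * ι h)}) ∧
    (∀ g, X.inv (π g) = π g⁻¹)

/-- `X` is isomorphic to the coset two-valued group `X^a_A = A/ι_a`
for the antipodal involution `ι_a (a) = a⁻¹` of the abelian group `A`. -/
def IsAntipodalCosetOf {T : Type u} (X : TwoValuedGroup T) (A : Type v) [CommGroup A] : Prop :=
  ∃ π : A → T, Function.Surjective π ∧ π 1 = X.e ∧
    (∀ a, π a⁻¹ = π a) ∧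
    (∀ a b, π a = π b → b = a ∨ b = a⁻¹) ∧
    (∀ a b, X.mul (π a) (π b) = {π (a * b), π (a * b⁻¹)}) ∧
    (∀ a, X.inv (π a) = π a⁻¹)

/-- A Boolean group: every element squares to the identity. -/
def IsBooleanGroup (V : Type v) [CommGroup V] : Prop := ∀ x : V, x * x = 1

/-- For a Boolean group, `dim V ≥ 2` (as an `𝔽₂`-vector space) is equivalent to the
existence of two distinct nontrivial elements. -/
def BoolDimGE2 (V : Type v) [CommGroup V] : Prop := ∃ a b : V, a ≠ 1 ∧ b ≠ 1 ∧ a ≠ b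

/-- For a Boolean group, `dim V ≥ 3` is equivalent to the existence of three
linearly independent elements. -/
def BoolDimGE3 (V : Type v) [CommGroup V] : Prop :=
  ∃ a b c : V, a ≠ 1 ∧ b ≠ 1 ∧ a ≠ b ∧ c ≠ 1 ∧ c ≠ a ∧ c ≠ b ∧ c ≠ a * b

/-- Isomorphism of (single-valued) groups. -/
def GroupIsomorphic (A : Type v) (B : Type w) [CommGroup A] [CommGroup B] : Prop :=
  Nonempty (A ≃* B)

/-- `X` is isomorphic to the coset two-valued group `X^u_V = (V × V)/ι_u`,
where `ι_u (a, b) = (a, a b)` is the unipotent involution of the Boolean group `V × V`. -/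
def IsUnipotentCosetOf {T : Type u} (X : TwoValuedGroup T) (V : Type v) [CommGroup V] : Prop :=
  ∃ π : V × V → T, Function.Surjective π ∧ π (1, 1) = X.e ∧
    (∀ a b : V, π (a, a * b) = π (a, b)) ∧
    (∀ p q : V × V, π p = π q → q = p ∨ q = (p.1, p.1 * p.2)) ∧
    (∀ a₁ b₁ a₂ b₂ : V,
      X.mul (π (a₁, b₁)) (π (a₂, b₂)) = {π (a₁ * a₂, b₁ * b₂), π (a₁ * a₂, a₂ * b₁ * b₂)}) ∧
    (∀ p : V × V, X.inv (π p) = π p)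

/-- `X` is isomorphic to the direct product `X^u_V × W` of the unipotent coset
two-valued group `X^u_V = (V × V)/ι_u` and the Boolean group `W`. -/
def IsUnipotentCosetProdOf {T : Type u} (X : TwoValuedGroup T) (V : Type v) (W : Type w)
    [CommGroup V] [CommGroup W] : Prop :=
  ∃ f : (V × V) × W → T, Function.Surjective f ∧ f ((1, 1), 1) = X.e ∧
    (∀ (a b : V) (w : W), f ((a, a * b), w) = f ((a, b), w)) ∧
    (∀ p q : (V × V) × W, f p = f q → q.2 = p.2 ∧ (q.1 = p.1 ∨ q.1 = (p.1.1, p.1.1 * p.1.2))) ∧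
    (∀ (a₁ b₁ a₂ b₂ : V) (w₁ w₂ : W),
      X.mul (f ((a₁, b₁), w₁)) (f ((a₂, b₂), w₂)) =
        {f ((a₁ * a₂, b₁ * b₂), w₁ * w₂), f ((a₁ * a₂, a₂ * b₁ * b₂), w₁ * w₂)}) ∧
    (∀ p, X.inv (f p) = f p)

open Classical in
/-- The multiplication table of the special two-valued group `Y_V` on `Option V`:
`none` is the extra element `s`, `some v` are the elements of the Boolean group `V`. -/
noncomputable def mulY {V : Type v} [CommGroup V] : Option V → Option V → Multiset (Option V)
  | some x, some y =>
      if x = y then (if x = 1 then {some 1, some 1} else {some 1, none})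
      else {some (x * y), some (x * y)}
  | some x, none => if x = 1 then {none, none} else {some x, some x}
  | none, some y => if y = 1 then {none, none} else {some y, some y}
  | none, none => {some 1, some 1}

/-- `X` is isomorphic to the special two-valued group `Y_V`. -/
def IsYOf {T : Type u} (X : TwoValuedGroup T) (V : Type v) [CommGroup V] : Prop :=
  ∃ f : Option V → T, Function.Bijective f ∧ f (some 1) = X.e ∧
    (∀ uu vv : Option V, X.mul (f uu) (f vv) = (mulY uu vv).map f) ∧
    (∀ uu : Option V, X.inv (f uu) = f uu)

/-- `X` is isomorphic to the direct product `Y_V × W`. -/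
def IsYProdOf {T : Type u} (X : TwoValuedGroup T) (V : Type v) (W : Type w)
    [CommGroup V] [CommGroup W] : Prop :=
  ∃ f : Option V × W → T, Function.Bijective f ∧ f (some 1, 1) = X.e ∧
    (∀ (uu vv : Option V) (w₁ w₂ : W),
      X.mul (f (uu, w₁)) (f (vv, w₂)) = (mulY uu vv).map (fun z => f (z, w₁ * w₂))) ∧
    (∀ p : Option V × W, X.inv (f p) = f p)

/-- `X` is isomorphic to the direct product `X' × W` of the two-valued group `X'`
and the (single-valued) Boolean group `W`. -/
def IsDirectProdOf {T : Type u} {T' : Type v} (W : Type w) [CommGroup W]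
    (X : TwoValuedGroup T) (X' : TwoValuedGroup T') : Prop :=
  ∃ f : T' × W → T, Function.Bijective f ∧ f (X'.e, 1) = X.e ∧
    (∀ (x₁ x₂ : T') (w₁ w₂ : W),
      X.mul (f (x₁, w₁)) (f (x₂, w₂)) = (X'.mul x₁ x₂).map (fun z => f (z, w₁ * w₂))) ∧
    (∀ (x : T') (w : W), X.inv (f (x, w)) = f (X'.inv x, w))

/-- `X` contains a single-valued direct factor: `X ≅ X' × W` with `W` a nontrivial
Boolean group. -/
def HasSingleValuedDirectFactor {T : Type u} (X : TwoValuedGroup T) : Prop :=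
  ∃ (T' : Type u) (X' : TwoValuedGroup T') (W : Type u) (iW : CommGroup W),
    X'.Commutative ∧ X'.Involutive ∧ @IsBooleanGroup W iW ∧ Nontrivial W ∧
    @IsDirectProdOf T T' W iW X X'

/-- The Boolean group `C₂ⁿ`. -/
abbrev C2vec (n : ℕ) : Type := Fin n → Multiplicative (ZMod 2)

/-- The group `C₄ⁿ`. -/
abbrev C4vec (n : ℕ) : Type := Fin n → Multiplicative (ZMod 4)

end TwoValuedGroup

namespace TwoValuedGroup

section Basic

variable {T : Type u} {X : TwoValuedGroup T}

/-- The product of two multisets of elements of a two-valued group. -/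
def mulMultiset (X : TwoValuedGroup T) (A B : Multiset T) : Multiset T :=
  A.bind fun a => B.bind fun b => X.mul a b

theorem mulMultiset_singleton (a b : T) : X.mulMultiset {a} {b} = X.mul a b := by
  simp [mulMultiset]

theorem mulMultiset_pair (a b c d : T) :
    X.mulMultiset {a, b} {c, d} = X.mul a c + X.mul a d + (X.mul b c + X.mul b d) := by
  simp only [mulMultiset, Multiset.insert_eq_cons, Multiset.cons_bind, Multiset.singleton_bind]

theorem Commutative.mulMultiset_comm (hc : X.Commutative) (A B : Multiset T) :
    X.mulMultiset A B = X.mulMultiset B A := by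
  unfold mulMultiset
  rw [Multiset.bind_bind]
  simp only [hc _ _]

theorem mulMultiset_assoc (A B C : Multiset T) :
    X.mulMultiset (X.mulMultiset A B) C = X.mulMultiset A (X.mulMultiset B C) := by
  simp only [mulMultiset, Multiset.bind_assoc]
  refine Multiset.bind_congr fun a _ => Multiset.bind_congr fun b _ => ?_
  rw [Multiset.bind_bind]
  exact Multiset.bind_congr fun c _ => X.assoc a b c

theorem Commutative.medial (hc : X.Commutative) (a b c d : T) :
    X.mulMultiset (X.mul a b) (X.mul c d) = X.mulMultiset (X.mul a c) (X.mul b d) := by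
  have : Std.Associative X.mulMultiset := ⟨mulMultiset_assoc⟩
  have : Std.Commutative X.mulMultiset := ⟨hc.mulMultiset_comm⟩
  simp only [← mulMultiset_singleton]
  ac_rfl

theorem exists_mul_eq (X : TwoValuedGroup T) (x y : T) : ∃ p q, X.mul x y = {p, q} :=
  Multiset.card_eq_two.1 (X.card_mul x y)

theorem exists_mem_mul (X : TwoValuedGroup T) (x y : T) : ∃ p, p ∈ X.mul x y := by
  obtain ⟨p, q, h⟩ := X.exists_mul_eq x y
  exact ⟨p, by simp [h]⟩

theorem exists_mul_eq_of_mem {x y p : T} (h : p ∈ X.mul x y) : ∃ q, X.mul x y = {p, q} := by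
  obtain ⟨A, hA⟩ := Multiset.exists_cons_of_mem h
  have h2 := X.card_mul x y
  rw [hA, Multiset.card_cons] at h2
  obtain ⟨q, rfl⟩ := Multiset.card_eq_one.1 (by omega : A.card = 1)
  exact ⟨q, hA⟩

theorem exists_mem_mul_assoc {x y z t p : T} (ht : t ∈ X.mul x y) (hp : p ∈ X.mul t z) :
    ∃ r ∈ X.mul y z, p ∈ X.mul x r := by
  have h : p ∈ (X.mul x y).bind fun t => X.mul t z := Multiset.mem_bind.2 ⟨t, ht, hp⟩
  rw [X.assoc] at h
  exact Multiset.mem_bind.1 h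

theorem Involutive.e_mem_mul (hi : X.Involutive) {x y : T} : X.e ∈ X.mul x y ↔ y = x := by
  constructor
  · intro h
    rw [X.inv_unique x y (Or.inl h), hi]
  · rintro rfl
    simpa [hi y] using X.e_mem_mul_inv y

theorem Involutive.mem_mul_rotate (hi : X.Involutive) {x y z : T} (h : z ∈ X.mul x y) :
    x ∈ X.mul y z := by
  obtain ⟨r, hr, he⟩ := exists_mem_mul_assoc h (hi.e_mem_mul.2 (rfl : z = z))
  rwa [hi.e_mem_mul.1 he] at hr

theorem eq_of_pair_add_two_nsmul_eq {α : Type*} {a b c d : α} {M N : Multiset α}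
    (h : {a, b} + (M + M) = {c, d} + (N + N)) :
    a = c ∧ b = d ∨ a = d ∧ b = c ∨ a = b ∧ c = d := by
  classical
  have ha := congrArg (Multiset.count a) h
  have hb := congrArg (Multiset.count b) h
  have hc := congrArg (Multiset.count c) h
  simp only [Multiset.count_add, Multiset.insert_eq_cons, Multiset.count_cons,
    Multiset.count_singleton] at ha hb hc
  split_ifs at ha hb hc <;> grind

theorem add_self_inj {α : Type*} {M N : Multiset α} (h : M + M = N + N) : M = N := by
  classical
  ext t
  have := congrArg (Multiset.count t) h
  simp only [Multiset.count_add] at this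
  omega

end Basic

section Squares

variable {T : Type u} {X : TwoValuedGroup T} {sq : T → T}

theorem sq_identity (hc : X.Commutative) (hsq : ∀ x, X.mul x x = {X.e, sq x}) {u v p q : T}
    (h : X.mul u v = {p, q}) :
    {sq p, sq q} + (X.mul p q + X.mul p q) =
      X.mul (sq u) (sq v) + ({sq u, sq v} + {sq u, sq v}) := by
  have H := hc.medial u v u v
  rw [h, hsq u, hsq v, mulMultiset_pair, mulMultiset_pair, hsq p, hsq q, hc q p, X.e_mul, X.e_mul,
    X.mul_e] at H
  classical
  ext t
  have := congrArg (Multiset.count t) H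
  simp only [Multiset.count_add, Multiset.insert_eq_cons, Multiset.count_cons,
    Multiset.count_singleton] at this ⊢
  omega

/-- Multiplication by an element of order at most two is single-valued. -/
theorem exists_mul_eq_of_sq_eq_e (hc : X.Commutative) (hi : X.Involutive)
    (hsq : ∀ x, X.mul x x = {X.e, sq x}) {a : T} (ha : sq a = X.e) (x : T) :
    ∃ z, X.mul a x = {z, z} := by
  obtain ⟨p, q, h⟩ := X.exists_mul_eq a x
  have hp : ∀ p ∈ X.mul a x, ∀ t ∈ X.mul a p, t = x := by
    intro p hp t ht
    have h1 : t ∈ (X.mul a x).bind fun b => X.mul a b := Multiset.mem_bind.2 ⟨p, hp, ht⟩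
    rw [← X.assoc, hsq, ha] at h1
    simpa [X.e_mul] using h1
  have hxx : ∀ p ∈ X.mul a x, X.mul a p = {x, x} := by
    intro p hpm
    obtain ⟨c, d, hcd⟩ := X.exists_mul_eq a p
    rw [hcd, hp p hpm c (by simp [hcd]), hp p hpm d (by simp [hcd])]
  have H := hc.medial a p a q
  rw [hxx p (by simp [h]), hxx q (by simp [h]), hsq a, ha, mulMultiset_pair] at H
  have he : X.e ∈ X.mulMultiset {X.e, X.e} (X.mul p q) := by
    rw [← H]
    simp [hi.e_mem_mul]
  obtain ⟨c, d, hcd⟩ := X.exists_mul_eq p q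
  rw [hcd, mulMultiset_pair] at he
  have he' : X.e ∈ X.mul p q := by
    rw [hcd]
    simp only [X.e_mul] at he
    simp at he ⊢
    tauto
  rw [hi.e_mem_mul.1 he'] at h
  exact ⟨p, h⟩

theorem mul_eq_pair_of_mem (hc : X.Commutative) (hi : X.Involutive)
    (hsq : ∀ x, X.mul x x = {X.e, sq x}) {a x z : T} (ha : sq a = X.e) (hz : z ∈ X.mul a x) :
    X.mul a x = {z, z} := by
  obtain ⟨t, ht⟩ := exists_mul_eq_of_sq_eq_e hc hi hsq ha x
  have : z = t := by simpa [ht] using hz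
  rw [this, ht]

theorem sq_e (hsq : ∀ x, X.mul x x = {X.e, sq x}) : sq X.e = X.e := by
  have := hsq X.e
  rw [X.e_mul] at this
  have h2 : sq X.e ∈ ({X.e, X.e} : Multiset T) := by rw [this]; simp
  simpa using h2

theorem sq_eq_of_mem (hc : X.Commutative) (hi : X.Involutive)
    (hsq : ∀ x, X.mul x x = {X.e, sq x}) {a x z : T} (ha : sq a = X.e) (hz : z ∈ X.mul a x) :
    sq z = sq x := by
  have h := sq_identity hc hsq (mul_eq_pair_of_mem hc hi hsq ha hz)
  rw [ha, X.e_mul, hsq z] at h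
  have h1 : sq z ∈ ({sq z, sq z} : Multiset T) + ({X.e, sq z} + {X.e, sq z}) := by simp
  have h2 : sq x ∈ ({sq z, sq z} : Multiset T) + ({X.e, sq z} + {X.e, sq z}) := by rw [h]; simp
  rw [h] at h1
  simp at h1 h2
  grind

/-- The squares in a special pair coincide and have order two. -/
theorem sq_eq_of_special (hc : X.Commutative) (hsq : ∀ x, X.mul x x = {X.e, sq x})
    {x y z : T} (hx : sq x ≠ X.e) (hy : sq y ≠ X.e) (h : X.mul x y = {z, z}) :
    sq x = sq z ∧ sq y = sq z ∧ sq (sq z) = X.e := by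
  have H := sq_identity hc hsq h
  rw [hsq z] at H
  have h1 : sq x ∈ ({sq z, sq z} : Multiset T) + ({X.e, sq z} + {X.e, sq z}) := by rw [H]; simp
  have h2 : sq y ∈ ({sq z, sq z} : Multiset T) + ({X.e, sq z} + {X.e, sq z}) := by rw [H]; simp
  have h1 : sq x = sq z := by simp at h1; tauto
  have h2 : sq y = sq z := by simp at h2; tauto
  refine ⟨h1, h2, ?_⟩
  rw [h1, h2, hsq (sq z)] at H
  have hz : sq z ≠ X.e := h1 ▸ hx
  classical
  have := congrArg (Multiset.count X.e) H
  simp only [Multiset.count_add, Multiset.insert_eq_cons, Multiset.count_cons,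
    Multiset.count_singleton, hz.symm, if_false, if_true] at this
  split_ifs at this with h3
  · exact h3.symm
  · omega

/-- If `s` has order at most two and `v² = s`, then the squares of the two elements of `u * v`
coincide. -/
theorem sq_mul_of_sq_eq (hc : X.Commutative) (hi : X.Involutive)
    (hsq : ∀ x, X.mul x x = {X.e, sq x}) {s u v p q : T} (hs : sq s = X.e) (hv : sq v = s)
    (h : X.mul u v = {p, q}) :
    ∃ r, X.mul s (sq u) = {r, r} ∧ sq p = sq q ∧ {sq p} + X.mul p q = {sq u, s, r} := by
  obtain ⟨r, hr⟩ := exists_mul_eq_of_sq_eq_e hc hi hsq hs (sq u)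
  have H := sq_identity hc hsq h
  rw [hv, hc _ s, hr] at H
  have hpq : sq p = sq q := by
    have := eq_of_pair_add_two_nsmul_eq H
    grind
  refine ⟨r, hr, hpq, add_self_inj ?_⟩
  rw [← hpq] at H
  classical
  ext t
  have := congrArg (Multiset.count t) H
  simp only [Multiset.count_add, Multiset.insert_eq_cons, Multiset.count_cons,
    Multiset.count_singleton] at this ⊢
  omega

/-- A product of two square roots of an element `s` of order at most two. -/
theorem mul_of_sq_eq_of_sq_eq (hc : X.Commutative) (hi : X.Involutive)
    (hsq : ∀ x, X.mul x x = {X.e, sq x}) {s u v p q : T} (hs : sq s = X.e)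
    (hu : sq u = s) (hv : sq v = s) (h : X.mul u v = {p, q}) :
    p = q ∧ sq p = s ∨ sq p = X.e ∧ X.mul s p = {q, q} := by
  obtain ⟨r, hr, -, H⟩ := sq_mul_of_sq_eq hc hi hsq hs hv h
  have hre : r = X.e := by
    rw [hu, hsq, hs] at hr
    have : r ∈ ({X.e, X.e} : Multiset T) := by rw [hr]; simp
    simpa using this
  rw [hu, hre] at H
  by_cases hp : sq p = X.e
  · right
    refine ⟨hp, ?_⟩
    have h1 : X.mul p q = {s, s} := by
      rw [hp] at H
      classical
      ext t
      have := congrArg (Multiset.count t) H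
      simp only [Multiset.count_add, Multiset.insert_eq_cons, Multiset.count_cons,
        Multiset.count_singleton] at this ⊢
      omega
    refine mul_eq_pair_of_mem hc hi hsq hs ?_
    have h2 : s ∈ X.mul q p := by rw [hc, h1]; simp
    rw [hc]
    exact hi.mem_mul_rotate h2
  · left
    have h1 : X.e ∈ ({sq p} : Multiset T) + X.mul p q := by rw [H]; simp
    have h2 : q = p := hi.e_mem_mul.1 (by
      rcases Multiset.mem_add.1 h1 with h1 | h1
      · exact absurd (Multiset.mem_singleton.1 h1).symm hp
      · exact h1)
    refine ⟨h2.symm, ?_⟩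
    have h3 : sq p ∈ ({s, s, X.e} : Multiset T) := by rw [← H]; simp
    simpa [hp] using h3

theorem sq_mem_mul (hc : X.Commutative) (hi : X.Involutive)
    (hsq : ∀ x, X.mul x x = {X.e, sq x}) {s w x p : T} (hs : sq s = X.e) (hx : sq x = s)
    (hwe : sq w ≠ X.e) (hws : sq w ≠ s) (hp : p ∈ X.mul w x) :
    sq p ≠ X.e ∧ sq p ≠ s ∧ (sq p = sq w ∨ sq p ∈ X.mul s (sq w)) := by
  obtain ⟨q, h⟩ := exists_mul_eq_of_mem hp
  obtain ⟨r, hr, -, H⟩ := sq_mul_of_sq_eq hc hi hsq hs hx h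
  have hmem : sq p ∈ ({sq w, s, r} : Multiset T) := by rw [← H]; simp
  have hps : sq p ≠ s := by
    intro hps
    have hw : w ∈ X.mul p x := by rw [hc]; exact hi.mem_mul_rotate hp
    obtain ⟨w', hw'⟩ := exists_mul_eq_of_mem hw
    rcases mul_of_sq_eq_of_sq_eq hc hi hsq hs hps hx hw' with h1 | h1
    · exact hws h1.2
    · exact hwe h1.1
  have hpe : sq p ≠ X.e := by
    intro hpe
    rw [hpe] at hmem
    simp only [Multiset.insert_eq_cons, Multiset.mem_cons, Multiset.mem_singleton] at hmem
    rcases hmem with h1 | h1 | h1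
    · exact hwe h1.symm
    · exact hps (hpe.trans h1)
    · rw [← h1] at hr
      exact hws (hi.e_mem_mul.1 (by rw [hr]; simp))
  refine ⟨hpe, hps, ?_⟩
  simp only [Multiset.insert_eq_cons, Multiset.mem_cons, Multiset.mem_singleton] at hmem
  rw [hr]
  simp
  tauto

theorem sq_sq_eq_of_sq_eq (hc : X.Commutative) (hi : X.Involutive)
    (hsq : ∀ x, X.mul x x = {X.e, sq x}) {s w x p : T} (hse : s ≠ X.e) (hx : sq x = s)
    (hws : sq w ≠ s) (hp : p ∈ X.mul w x) (hpw : sq p = sq w) :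
    sq (sq w) = s ∧ ∃ k, sq k = X.e ∧ sq w ∈ X.mul k x := by
  obtain ⟨k, hk⟩ := exists_mul_eq_of_mem (hi.mem_mul_rotate (hc w x ▸ hp))
  have H := sq_identity hc hsq hk
  rw [hx, hpw, hsq (sq w)] at H
  rcases eq_of_pair_add_two_nsmul_eq H with ⟨h1, -⟩ | ⟨h1, h2⟩ | ⟨h1, h2⟩
  · exact absurd h1 hse
  · refine ⟨h1.symm, k, h2, ?_⟩
    rw [← h1, h2, Multiset.pair_comm] at H
    have := add_self_inj (add_left_cancel H)
    rw [hc, this]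
    simp
  · have h3 : s ∈ ({X.e, sq (sq w)} : Multiset T) + ({sq w, sq w} + {sq w, sq w}) := by
      rw [← H]; simp
    rw [← h2] at h3
    simp [hse, hws.symm] at h3

/-- In the presence of a special pair with squares `s`, all squares are `e` or `s`. -/
theorem sq_eq_of_exists_special (hc : X.Commutative) (hi : X.Involutive)
    (hsq : ∀ x, X.mul x x = {X.e, sq x}) {s x y z : T} (hs : sq s = X.e) (hse : s ≠ X.e)
    (hx : sq x = s) (hy : sq y = s) (hz : sq z = s) (h : X.mul x y = {z, z}) (w : T) :
    sq w = X.e ∨ sq w = s := by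
  by_contra! hw
  obtain ⟨hwe, hws⟩ := hw
  by_cases hw4 : sq (sq w) = s
  · have key : ∀ t, sq t = s → ∃ k, sq k = X.e ∧ sq w ∈ X.mul k t := by
      intro t ht
      obtain ⟨p, hp⟩ := X.exists_mem_mul w t
      refine (sq_sq_eq_of_sq_eq hc hi hsq hse ht hws hp ?_).2
      rcases (sq_mem_mul hc hi hsq hs ht hwe hws hp).2.2 with h1 | h1
      · exact h1
      · have h2 : sq w ∈ X.mul s (sq w) := by
          rw [hc]
          exact hi.mem_mul_rotate (by simp [hsq, hw4])
        rw [mul_eq_pair_of_mem hc hi hsq hs h2] at h1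
        simpa using h1
    obtain ⟨k, hk, hkx⟩ := key x hx
    obtain ⟨l, hl, hly⟩ := key y hy
    have h1 : x ∈ X.mul (sq w) k := hi.mem_mul_rotate (hi.mem_mul_rotate hkx)
    have h2 : sq w ∈ X.mul y l := hc l y ▸ hly
    obtain ⟨b, hb, hxb⟩ := exists_mem_mul_assoc h2 h1
    have hbe : sq b = X.e := by
      rw [sq_eq_of_mem hc hi hsq hl hb, hk]
    have h3 : b ∈ X.mul x y := hi.mem_mul_rotate (hi.mem_mul_rotate hxb)
    rw [h] at h3
    have h4 : b = z := by simpa using h3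
    exact hse (by rw [← hz, ← h4, hbe])
  · have key : ∀ t, sq t = s → ∀ p ∈ X.mul w t, sq p ∈ X.mul s (sq w) := by
      intro t ht p hp
      rcases (sq_mem_mul hc hi hsq hs ht hwe hws hp).2.2 with h1 | h1
      · exact absurd (sq_sq_eq_of_sq_eq hc hi hsq hse ht hws hp h1).1 hw4
      · exact h1
    obtain ⟨p, hp⟩ := X.exists_mem_mul w x
    obtain ⟨q, hq⟩ := X.exists_mem_mul p y
    obtain ⟨z', hz', hqz⟩ := exists_mem_mul_assoc hp hq
    have hzz : z' = z := by simpa [h] using hz'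
    rw [hzz] at hqz
    have h1 := key x hx p hp
    have h2 := key z hz q hqz
    have hqp : sq q = sq p := by
      rw [mul_eq_pair_of_mem hc hi hsq hs h1] at h2
      simpa using h2
    have h3 := sq_mem_mul hc hi hsq hs hx hwe hws hp
    have h4 := (sq_sq_eq_of_sq_eq hc hi hsq hse hy h3.2.1 hq hqp).1
    exact hw4 (by rw [← h4, sq_eq_of_mem hc hi hsq hs h1])

end Squares

section DirectFactor

variable {T : Type u} {X : TwoValuedGroup T} {sq : T → T}

/-- A homomorphism to the group of order two that is nontrivial on some element of order two
splits off a single-valued direct factor. -/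
theorem hasSingleValuedDirectFactor_of_hom (hc : X.Commutative) (hi : X.Involutive)
    (hsq : ∀ x, X.mul x x = {X.e, sq x}) {a : T} (ha : sq a = X.e)
    (φ : T → Multiplicative (ZMod 2)) (hφ : ∀ x y, ∀ t ∈ X.mul x y, φ t = φ x * φ y)
    (hφa : φ a ≠ 1) : HasSingleValuedDirectFactor X := by
  classical
  choose A hA using exists_mul_eq_of_sq_eq_e hc hi hsq ha
  have hmul : ∀ x y, X.mul (A x) y = (X.mul x y).map A := by
    intro x y
    apply add_self_inj
    have h := X.assoc a x y
    obtain ⟨p, q, hpq⟩ := X.exists_mul_eq x y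
    rw [hA, hpq] at h
    simp only [Multiset.insert_eq_cons, Multiset.cons_bind, Multiset.singleton_bind, hA] at h
    rw [hpq, h]
    ext t
    simp only [Multiset.insert_eq_cons, Multiset.map_cons, Multiset.map_singleton,
      Multiset.count_add, Multiset.count_cons, Multiset.count_singleton]
    omega
  have hmul' : ∀ x y, X.mul x (A y) = (X.mul x y).map A := fun x y => by
    rw [hc, hmul, hc]
  have hAA : ∀ x, A (A x) = x := by
    intro x
    have h : x ∈ X.mul a (A x) := hc _ a ▸ hi.mem_mul_rotate (hi.mem_mul_rotate (by simp [hA]))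
    rw [hA] at h
    exact (by simpa using h : x = A (A x)).symm
  have hφe : φ X.e = 1 := by
    have := hφ X.e X.e X.e (by simp [X.e_mul])
    simpa using this
  have hφA : ∀ x, φ (A x) = φ a * φ x := fun x => hφ a x _ (by simp [hA])
  have htwo : ∀ g h : Multiplicative (ZMod 2), g ≠ 1 → h ≠ 1 → g * h = 1 := by decide
  let T' : Type u := {x : T // φ x = 1}
  let r : T → T' := fun x =>
    if h : φ x = 1 then ⟨x, h⟩ else ⟨A x, by rw [hφA]; exact htwo _ _ hφa h⟩
  have hr : ∀ x, φ x = 1 → (r x).1 = x := fun x h => by simp [r, h]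
  have hφmul : ∀ x y : T', ∀ t ∈ X.mul x.1 y.1, φ t = 1 := fun x y t ht => by
    rw [hφ _ _ t ht, x.2, y.2, one_mul]
  have hval : ∀ x y : T', ((X.mul x.1 y.1).map r).map Subtype.val = X.mul x.1 y.1 := by
    intro x y
    rw [Multiset.map_map]
    conv_rhs => rw [← Multiset.map_id (X.mul x.1 y.1)]
    exact Multiset.map_congr rfl fun t ht => hr t (hφmul x y t ht)
  have hmem : ∀ x y z : T', z ∈ (X.mul x.1 y.1).map r ↔ z.1 ∈ X.mul x.1 y.1 := by
    intro x y z
    rw [← hval x y, Multiset.mem_map_of_injective Subtype.val_injective, hval x y]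
  let e' : T' := ⟨X.e, hφe⟩
  have hre : ∀ x : T', r x.1 = x := fun x => Subtype.ext (hr _ x.2)
  let X' : TwoValuedGroup T' :=
    { mul := fun x y => (X.mul x.1 y.1).map r
      e := e'
      inv := id
      card_mul := fun x y => by simp [X.card_mul]
      assoc := fun x y z => by
        apply Multiset.map_injective Subtype.val_injective
        simp only [Multiset.map_bind, hval, Multiset.bind_map]
        have h1 : ∀ t ∈ X.mul x.1 y.1, X.mul (r t).1 z.1 = X.mul t z.1 := fun t ht => by
          rw [hr t (hφmul x y t ht)]
        have h2 : ∀ t ∈ X.mul y.1 z.1, X.mul x.1 (r t).1 = X.mul x.1 t := fun t ht => by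
          rw [hr t (hφmul y z t ht)]
        rw [Multiset.bind_congr h1, Multiset.bind_congr h2, X.assoc]
      e_mul := fun x => by simp [e', X.e_mul, hre]
      mul_e := fun x => by simp [e', X.mul_e, hre]
      e_mem_mul_inv := fun x => (hmem _ _ _).2 (hi.e_mem_mul.2 rfl)
      e_mem_inv_mul := fun x => (hmem _ _ _).2 (hi.e_mem_mul.2 rfl)
      inv_unique := fun x y h => by
        simp only [hmem] at h
        rcases h with h | h
        · exact Subtype.ext (hi.e_mem_mul.1 h)
        · exact Subtype.ext (hi.e_mem_mul.1 h).symm }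
  refine ⟨T', X', ULift (Multiplicative (ZMod 2)), inferInstance,
    fun x y => congrArg (Multiset.map r) (hc x.1 y.1), fun x => rfl, ?_, inferInstance,
    fun p => if p.2.down = 1 then p.1.1 else A p.1.1, ?_, by simp [X', e'], ?_, ?_⟩
  · rintro ⟨x⟩
    apply ULift.ext
    revert x
    decide
  · constructor
    · rintro ⟨x, w⟩ ⟨y, w'⟩ h
      have hφf : ∀ (x : T') (w : ULift (Multiplicative (ZMod 2))),
          φ (if w.down = 1 then x.1 else A x.1) = w.down := by
        intro x w
        split_ifs with h
        · rw [x.2, h]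
        · rw [hφA, x.2, mul_one]
          have : ∀ g h : Multiplicative (ZMod 2), g ≠ 1 → h ≠ 1 → g = h := by decide
          exact this _ _ hφa h
      have hw : w = w' := ULift.ext _ _ (by
        have := congrArg φ h
        exact (hφf x w).symm.trans (this.trans (hφf y w')))
      subst hw
      simp only at h
      refine Prod.ext (Subtype.ext ?_) rfl
      split_ifs at h with h1
      · exact h
      · rw [← hAA x.1, h, hAA]
    · intro t
      by_cases h : φ t = 1
      · exact ⟨(⟨t, h⟩, 1), by simp⟩
      · exact ⟨(⟨A t, by rw [hφA]; exact htwo _ _ hφa h⟩, ⟨φ t⟩), by simp [h, hAA]⟩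
  · rintro x y ⟨w⟩ ⟨w'⟩
    have hmap : ∀ g : T → T,
        (X'.mul x y).map (fun z => g z.1) = (X.mul x.1 y.1).map g := by
      intro g
      rw [← hval x y, Multiset.map_map (g := g)]
      rfl
    by_cases h : w = 1 <;> by_cases h' : w' = 1
    · simpa [h, h'] using (hmap id).symm
    · simpa [h, h', hmul'] using (hmap A).symm
    · simpa [h, h', hmul] using (hmap A).symm
    · simpa [h, h', hmul, hmul', htwo w w' h h', hAA] using (hmap id).symm
  · intro x w
    exact hi _

end DirectFactor

section Quotient

variable {T : Type u} {X : TwoValuedGroup T}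

/-- If any two elements of a product differ by the action of an element `s` of order at most two,
then identifying `x` with `s * x` turns `X` into a Boolean group. -/
theorem exists_boolean_quotient (hc : X.Commutative) (hi : X.Involutive) {s : T}
    (hs : X.mul s s = {X.e, X.e})
    (hmul : ∀ x y, ∀ p ∈ X.mul x y, ∀ q ∈ X.mul x y, q = p ∨ q ∈ X.mul s p) :
    ∃ (V : Type u) (_ : CommGroup V) (π : T → V), IsBooleanGroup V ∧ Function.Surjective π ∧
      (∀ x y, ∀ t ∈ X.mul x y, π t = π x * π y) ∧
      ∀ x y, π x = π y ↔ y = x ∨ y ∈ X.mul s x := by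
  let r : Setoid T :=
    { r := fun x y => y = x ∨ y ∈ X.mul s x
      iseqv :=
        { refl := fun x => Or.inl rfl
          symm := by
            rintro x y (rfl | h)
            · exact Or.inl rfl
            · exact Or.inr (hc y s ▸ hi.mem_mul_rotate (hi.mem_mul_rotate h))
          trans := by
            rintro x y z (rfl | hy) (rfl | hz)
            · exact Or.inl rfl
            · exact Or.inr hz
            · exact Or.inr hy
            · left
              have h : z ∈ (X.mul s x).bind fun t => X.mul s t := Multiset.mem_bind.2 ⟨y, hy, hz⟩
              rw [← X.assoc, hs] at h
              simpa [X.e_mul] using h } }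
  have hr : ∀ x y, r x y ↔ y = x ∨ y ∈ X.mul s x := fun x y => Iff.rfl
  have hcongr : ∀ {x x' y p p'}, r x x' → p ∈ X.mul x y → p' ∈ X.mul x' y → r p p' := by
    intro x x' y p p' h hp hp'
    rcases h with rfl | h
    · exact hmul _ _ p hp p' hp'
    · obtain ⟨t, ht, hpt⟩ := exists_mem_mul_assoc h hp'
      exact r.trans (hmul _ _ p hp t ht) (Or.inr hpt)
  have hcongr₂ : ∀ {x x' y y' p p'}, r x x' → r y y' → p ∈ X.mul x y → p' ∈ X.mul x' y' →
      r p p' := by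
    intro x x' y y' p p' hx hy hp hp'
    obtain ⟨q, hq⟩ := X.exists_mem_mul x' y
    exact r.trans (hcongr hx hp hq) (hcongr hy (hc x' y ▸ hq) (hc x' y' ▸ hp'))
  choose c hcm using X.exists_mem_mul
  let m : Quotient r → Quotient r → Quotient r :=
    Quotient.map₂ c fun x x' hx y y' hy => hcongr₂ hx hy (hcm _ _) (hcm _ _)
  have hm : ∀ x y, ∀ t ∈ X.mul x y, (⟦t⟧ : Quotient r) = m ⟦x⟧ ⟦y⟧ := fun x y t ht =>
    Quotient.sound (hmul _ _ _ ht _ (hcm x y))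
  have hone : ∀ a, m ⟦X.e⟧ a = a := by
    rintro ⟨x⟩
    exact (hm X.e x x (by simp [X.e_mul])).symm
  have hcomm : ∀ a b, m a b = m b a := by
    rintro ⟨x⟩ ⟨y⟩
    exact hm y x (c x y) (hc x y ▸ hcm x y)
  have hself : ∀ a, m a a = ⟦X.e⟧ := by
    rintro ⟨x⟩
    exact (hm x x X.e (hi.e_mem_mul.2 rfl)).symm
  have hassoc : ∀ a b d, m (m a b) d = m a (m b d) := by
    rintro ⟨x⟩ ⟨y⟩ ⟨z⟩
    obtain ⟨t, ht, h⟩ := exists_mem_mul_assoc (hcm x y) (hcm (c x y) z)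
    change (⟦c (c x y) z⟧ : Quotient r) = m ⟦x⟧ (m ⟦y⟧ ⟦z⟧)
    rw [← hm y z t ht, ← hm x t _ h]
  let G : CommGroup (Quotient r) :=
    { mul := m
      mul_assoc := hassoc
      one := ⟦X.e⟧
      one_mul := hone
      mul_one := fun a => (hcomm _ _).trans (hone a)
      inv := id
      inv_mul_cancel := hself
      mul_comm := hcomm }
  exact ⟨Quotient r, G, Quotient.mk r, hself, Quotient.mk_surjective, hm,
    fun x y => Quotient.eq.trans (hr x y)⟩

end Quotient

/-- A nontrivial element of a Boolean group is detected by a character of order two. -/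
theorem IsBooleanGroup.exists_hom_ne_one {V : Type u} [CommGroup V] (hV : IsBooleanGroup V) {g : V}
    (hg : g ≠ 1) : ∃ χ : V →* Multiplicative (ZMod 2), χ g ≠ 1 := by
  let _ : Module (ZMod 2) (Additive V) := AddCommGroup.zmodModule fun x => by
    rw [two_nsmul]
    exact hV x.toMul
  have h : ¬ ∀ f : Module.Dual (ZMod 2) (Additive V), f (Additive.ofMul g) = 0 := by
    rw [Module.forall_dual_apply_eq_zero_iff]
    exact hg
  push Not at h
  obtain ⟨f, hf⟩ := h
  exact ⟨AddMonoidHom.toMultiplicativeRight f.toAddMonoidHom, hf⟩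

section Classification

variable {T : Type u} {X : TwoValuedGroup T} {sq : T → T}

/-- If all squares are `e` or `s`, then any two elements of a product differ by the action
of `s`. -/
theorem eq_or_mem_mul_of_mem_mul (hc : X.Commutative) (hi : X.Involutive)
    (hsq : ∀ x, X.mul x x = {X.e, sq x}) {s : T} (hs : sq s = X.e)
    (hall : ∀ w, sq w = X.e ∨ sq w = s) (x y : T) :
    ∀ p ∈ X.mul x y, ∀ q ∈ X.mul x y, q = p ∨ q ∈ X.mul s p := by
  intro p hp q hq
  rcases hall x with hx | hx
  · rw [mul_eq_pair_of_mem hc hi hsq hx hp] at hq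
    simp_all
  rcases hall y with hy | hy
  · rw [hc] at hp hq
    rw [mul_eq_pair_of_mem hc hi hsq hy hp] at hq
    simp_all
  obtain ⟨q', h⟩ := exists_mul_eq_of_mem hp
  rw [h] at hq
  rcases mul_of_sq_eq_of_sq_eq hc hi hsq hs hx hy h with h1 | h1
  · left
    simpa [← h1.1] using hq
  · rw [h1.2]
    simpa using hq

/-- A two-valued group with exactly two elements `e`, `s` of order at most two, all of whose other
elements have square `s`, is of the form `Y_V`. -/
theorem isYOf_of_sq_eq (hc : X.Commutative) (hi : X.Involutive)
    (hsq : ∀ x, X.mul x x = {X.e, sq x}) {s : T} (hs : sq s = X.e) (hse : s ≠ X.e)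
    (hall : ∀ w, w = X.e ∨ w = s ∨ sq w = s)
    {V : Type v} [CommGroup V] (π : T → V) (hsurj : Function.Surjective π)
    (hmul : ∀ x y, ∀ t ∈ X.mul x y, π t = π x * π y)
    (hπ : ∀ x y, π x = π y ↔ y = x ∨ y ∈ X.mul s x) : IsYOf X V := by
  classical
  have hss : X.mul s s = {X.e, X.e} := by rw [hsq, hs]
  have hπe : π X.e = 1 := by
    have := hmul X.e X.e X.e (by simp [X.e_mul])
    simpa using this
  have hπs : π s = 1 := by
    rw [← hπe]
    exact (hπ _ _).2 (Or.inr (by simp [hss]))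
  have hfix : ∀ u, sq u = s → X.mul s u = {u, u} := fun u hu =>
    mul_eq_pair_of_mem hc hi hsq hs (hc u s ▸ hi.mem_mul_rotate (by simp [hsq, hu]))
  have hker : ∀ u, π u = 1 → u = X.e ∨ u = s := by
    intro u hu
    rw [← hπe, hπ] at hu
    rcases hu with hu | hu
    · exact Or.inl hu.symm
    · exact Or.inr (hi.e_mem_mul.1 hu)
  let σ : V → T := fun g => if g = 1 then X.e else Function.surjInv hsurj g
  have hσ1 : σ 1 = X.e := by simp [σ]
  have hπσ : ∀ g, π (σ g) = g := by
    intro g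
    by_cases hg : g = 1
    · rw [hg, hσ1, hπe]
    · simp [σ, hg, Function.surjInv_eq hsurj g]
  have hσsq : ∀ g, g ≠ 1 → sq (σ g) = s := by
    intro g hg
    rcases hall (σ g) with h | h | h
    · exact absurd (by rw [← hπσ g, h, hπe]) hg
    · exact absurd (by rw [← hπσ g, h, hπs]) hg
    · exact h
  have hσs : ∀ g, σ g ≠ s := by
    intro g h
    by_cases hg : g = 1
    · rw [hg, hσ1] at h
      exact hse h.symm
    · exact hg (by rw [← hπσ g, h, hπs])
  have hσπ : ∀ t, t ≠ s → σ (π t) = t := by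
    intro t ht
    by_cases h1 : π t = 1
    · rw [h1, hσ1]
      exact ((hker t h1).resolve_right ht).symm
    · have h2 := (hπ (σ (π t)) t).1 (hπσ _)
      rw [hfix _ (hσsq _ h1)] at h2
      rcases h2 with h2 | h2
      · exact h2.symm
      · exact (by simpa using h2 : t = σ (π t)).symm
  refine ⟨fun o => o.elim s σ, ⟨?_, ?_⟩, hσ1, ?_, fun _ => hi _⟩
  · rintro (_ | g) (_ | h) hgh
    · rfl
    · exact absurd hgh.symm (hσs h)
    · exact absurd hgh (hσs g)
    · exact congrArg some (by rw [← hπσ g, ← hπσ h]; exact congrArg π hgh)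
  · intro t
    by_cases ht : t = s
    · exact ⟨none, ht.symm⟩
    · exact ⟨some (π t), hσπ t ht⟩
  · rintro (_ | g) (_ | h)
    · simp [mulY, hss, hσ1]
    · by_cases hh : h = 1
      · simp [mulY, hh, hσ1, X.mul_e]
      · simp [mulY, hh, hfix _ (hσsq h hh)]
    · by_cases hg : g = 1
      · simp [mulY, hg, hσ1, X.e_mul]
      · simp [mulY, hg, hc _ s, hfix _ (hσsq g hg)]
    · by_cases hg : g = 1
      · by_cases hh : h = 1
        · simp [mulY, hg, hh, hσ1, X.e_mul]
        · simp [mulY, hg, Ne.symm hh, hσ1, X.e_mul]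
      by_cases hh : h = 1
      · simp [mulY, hg, hh, hσ1, X.mul_e]
      by_cases hgh : g = h
      · subst hgh
        simp [mulY, hg, hσ1, hsq, hσsq g hg]
      · obtain ⟨p, q, hpq⟩ := X.exists_mul_eq (σ g) (σ h)
        have hp : π p = g * h := by
          rw [hmul (σ g) (σ h) p (by simp [hpq]), hπσ, hπσ]
        have hgh1 : g * h ≠ 1 := by
          intro h1
          have h2 : g * g = 1 := by
            rw [← hπe, ← hπσ g]
            exact (hmul (σ g) (σ g) X.e (hi.e_mem_mul.2 rfl)).symm
          exact hgh (mul_left_cancel (h2.trans h1.symm))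
        have hps : p ≠ s := fun h => hgh1 (by rw [← hp, h, hπs])
        have hqp : q = p := by
          rcases mul_of_sq_eq_of_sq_eq hc hi hsq hs (hσsq g hg) (hσsq h hh) hpq with h1 | h1
          · exact h1.1.symm
          · rcases hall p with h2 | h2 | h2
            · exact absurd (by rw [← hp, h2, hπe]) hgh1
            · exact absurd h2 hps
            · exact absurd (h2.symm.trans h1.1) hse
        simp [mulY, hgh, hpq, hqp, ← hp, hσπ p hps]

end Classification

theorem OrdGT2.pow_two_ne_e {T : Type u} {X : TwoValuedGroup T} {P : T → ℤ → T} {x : T}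
    (h : X.OrdGT2 P x) : P x 2 ≠ X.e := by
  intro h2
  have hmem : 2 ∈ {n : ℕ | 0 < n ∧ P x (n : ℤ) = X.e} := ⟨by norm_num, h2⟩
  have hle : X.ordOf P x ≤ 2 := Nat.sInf_le hmem
  have hpos : 0 < X.ordOf P x := (Nat.sInf_mem ⟨2, hmem⟩).1
  rcases h with h | h <;> omega

/-- **Theorem 11.1 (theorem_special_classify).** Every special involutive commutative
two-valued group without single-valued direct factors is isomorphic to `Y_V` for a
Boolean group `V` with `dim V ≥ 2`. -/
theorem special_classification {T : Type u} (X : TwoValuedGroup T)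
    (hc : X.Commutative) (hinv : X.Involutive)
    (P : T → ℤ → T) (hP : X.IsPowFamily P)
    (hs : X.IsSpecial P)
    (hnf : ¬ HasSingleValuedDirectFactor X) :
    ∃ (V : Type u) (iV : CommGroup V),
      @IsBooleanGroup V iV ∧ @BoolDimGE2 V iV ∧ @IsYOf T X V iV := by
  have hsq : ∀ x, X.mul x x = {X.e, P x 2} := by
    intro x
    obtain ⟨h0, h1, -, h⟩ := hP x
    simpa [h0, h1] using h 1 le_rfl
  obtain ⟨x, y, z, hx, hy, hxy⟩ := hs
  obtain ⟨hxz, hyz, hs⟩ := sq_eq_of_special (sq := fun x => P x 2) hc hsq hx.pow_two_ne_e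
    hy.pow_two_ne_e hxy
  have hse : P z 2 ≠ X.e := hxz ▸ hx.pow_two_ne_e
  have hall := sq_eq_of_exists_special hc hinv hsq hs hse hxz hyz rfl hxy
  obtain ⟨V, iV, π, hV, hsurj, hmul, hπ⟩ := exists_boolean_quotient hc hinv
    (by rw [hsq, hs]) (eq_or_mem_mul_of_mem_mul hc hinv hsq hs hall)
  have hπe : π X.e = 1 := by
    have := hmul X.e X.e X.e (by simp [X.e_mul])
    simpa using this
  have hker : ∀ u, π u = 1 → P u 2 = X.e := by
    intro u hu
    rw [← hπe, hπ] at hu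
    rcases hu with hu | hu
    · rw [← hu]
      exact sq_e hsq
    · rw [hinv.e_mem_mul.1 hu, hs]
  refine ⟨V, iV, hV, ⟨π x, π y, fun h => hx.pow_two_ne_e (hker x h),
    fun h => hy.pow_two_ne_e (hker y h), fun h => ?_⟩,
    isYOf_of_sq_eq (sq := fun x => P x 2) hc hinv hsq hs hse (fun w => ?_) π hsurj hmul hπ⟩
  · refine hse (hker z ?_)
    rw [hmul x y z (by simp [hxy]), h]
    exact hV _
  · by_contra! hw
    have hwe : P w 2 = X.e := (hall w).resolve_right hw.2.2
    have hπw : π w ≠ 1 := by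
      intro h
      rw [← hπe, hπ] at h
      rcases h with h | h
      · exact hw.1 h.symm
      · exact hw.2.1 (hinv.e_mem_mul.1 h)
    obtain ⟨χ, hχ⟩ := hV.exists_hom_ne_one hπw
    exact hnf (hasSingleValuedDirectFactor_of_hom (sq := fun x => P x 2) hc hinv hsq hwe
      (fun t => χ (π t)) (fun x y t ht => by rw [hmul x y t ht, map_mul]) hχ)

end TwoValuedGroup
end

section
/- Let X be an involutive commutative two-valued group and let Q ⊆ X be the subset consisting of all squares of elements of X, i.e. Q = {x² : x ∈ X}. Then Q is a subgroup of X: for any x, y ∈ X, both elements of the multiset x² * y² are squares of elements of X. -/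
/-!
Two-valued groups after V.M. Buchstaber, A.P. Veselov and A.A. Gaifullin.

`X.mul x y` is the two-element multiset `x * y`.
-/

universe u v w u' v' w'

namespace TwoValuedGroup

section

variable {T : Type u} {X : TwoValuedGroup T} {P : T → ℤ → T}

theorem bind_mul_self_eq (hc : X.Commutative) (x y : T) :
    (X.mul x x).bind (fun s => (X.mul y y).bind fun t => X.mul s t) =
      (X.mul x y).bind (fun s => (X.mul x y).bind fun t => X.mul s t) := by
  calc (X.mul x x).bind (fun s => (X.mul y y).bind fun t => X.mul s t)
      = (X.mul x x).bind (fun s => (X.mul s y).bind fun t => X.mul t y) := by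
        simp only [X.assoc]
    _ = ((X.mul x y).bind fun t => X.mul x t).bind (fun t => X.mul t y) := by
        rw [← Multiset.bind_assoc, X.assoc]
    _ = (X.mul x y).bind (fun s => (X.mul x y).bind fun t => X.mul s t) := by
        rw [Multiset.bind_assoc]
        refine Multiset.bind_congr fun t _ => ?_
        rw [hc x t, X.assoc]

theorem IsPowFamily.mul_self (hP : X.IsPowFamily P) (x : T) :
    X.mul x x = {X.e, P x 2} := by
  obtain ⟨h0, h1, -, h⟩ := hP x
  simpa [h0, h1] using h 1 le_rfl

theorem IsPowFamily.e_pow_two (hP : X.IsPowFamily P) : P X.e 2 = X.e := by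
  have h : P X.e 2 ∈ X.mul X.e X.e := by simp [hP.mul_self]
  simpa [X.e_mul] using h

theorem exists_mul_eq_pair (X : TwoValuedGroup T) (x y : T) : ∃ a b, X.mul x y = {a, b} :=
  Multiset.card_eq_two.mp (X.card_mul x y)

theorem mem_mul_of_mem_mul (hinv : X.Involutive) {x y z : T}
    (h : z ∈ X.mul x y) : x ∈ X.mul y z := by
  have he : X.e ∈ (X.mul x y).bind fun t => X.mul t z :=
    Multiset.mem_bind.mpr ⟨z, h, by simpa [hinv z] using X.e_mem_mul_inv z⟩
  rw [X.assoc] at he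
  obtain ⟨t, ht, het⟩ := Multiset.mem_bind.mp he
  have := X.inv_unique x t (Or.inl het)
  rwa [this, hinv x] at ht

theorem pair_eq_or_of_doubled_eq {a b c d p q r s : T}
    (h : ({a, a, b, b, r, s} : Multiset T) = {c, d, p, p, q, q}) :
    ({r, s} : Multiset T) = {c, d} ∨ (r = s ∧ c = d ∧ (c = a ∨ c = b ∨ c = r)) := by
  classical
  have key : (r = c ∧ s = d) ∨ (r = d ∧ s = c) ∨
      (r = s ∧ c = d ∧ (c = a ∨ c = b ∨ c = r)) := by
    have hr := congrArg (Multiset.count r) h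
    have hs := congrArg (Multiset.count s) h
    have hcc := congrArg (Multiset.count c) h
    have hd := congrArg (Multiset.count d) h
    simp only [Multiset.insert_eq_cons, Multiset.count_cons, Multiset.count_singleton]
      at hr hs hcc hd
    grind
  rcases key with ⟨rfl, rfl⟩ | ⟨rfl, rfl⟩ | h
  · exact Or.inl rfl
  · exact Or.inl (Multiset.pair_comm _ _)
  · exact Or.inr h

/-- If `x * y = [a, b]`, then either `x² * y² = [a², b²]`, or both sides consist of
equal elements and `a²` is one of `x²`, `y²` or the element of `x² * y²`. -/
theorem IsPowFamily.sq_mul_sq (hP : X.IsPowFamily P) (hc : X.Commutative) {x y a b r s : T}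
    (hab : X.mul x y = {a, b}) (hrs : X.mul (P x 2) (P y 2) = {r, s}) :
    ({r, s} : Multiset T) = {P a 2, P b 2} ∨
      (r = s ∧ P a 2 = P b 2 ∧ (P a 2 = P x 2 ∨ P a 2 = P y 2 ∨ P a 2 = r)) := by
  obtain ⟨p, q, hpq⟩ := X.exists_mul_eq_pair a b
  have h := bind_mul_self_eq hc x y
  apply pair_eq_or_of_doubled_eq (p := p) (q := q)
  simp only [hab, hP.mul_self, Multiset.insert_eq_cons, Multiset.cons_bind,
    Multiset.singleton_bind, X.e_mul, X.mul_e, hc b a] at h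
  rw [hrs, hpq] at h
  simp only [Multiset.insert_eq_cons, ← Multiset.singleton_add] at h ⊢
  apply add_left_cancel (a := ({X.e} + {X.e} : Multiset T))
    (b := {P x 2} + ({P x 2} + ({P y 2} + ({P y 2} + ({r} + {s})))))
    (c := {P a 2} + ({P b 2} + ({p} + ({p} + ({q} + {q})))))
  convert h using 1 <;> abel

theorem IsPowFamily.exists_eq_sq (hP : X.IsPowFamily P) (hc : X.Commutative)
    (hinv : X.Involutive) {x y a b r : T} (hab : X.mul x y = {a, b})
    (hr : X.mul (P x 2) (P y 2) = {r, r}) (hax : P a 2 = P x 2) :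
    ∃ w, r = P w 2 := by
  have ha : a ∈ X.mul y x := by simp [hc y x, hab]
  have hy : y ∈ X.mul x a := mem_mul_of_mem_mul hinv ha
  obtain ⟨q, hq⟩ := Multiset.exists_cons_of_mem hy
  obtain ⟨q, rfl⟩ := Multiset.card_eq_one.mp
    (by simpa [hq] using X.card_mul x a : Multiset.card q = 1)
  have hcases : P y 2 = X.e ∨ P y 2 = P (P x 2) 2 ∨ P y 2 = P x 2 := by
    rcases hP.sq_mul_sq hc (x := x) (y := a) hq (by rw [hax, hP.mul_self]) with h | ⟨-, -, h⟩
    · have : P y 2 ∈ ({X.e, P (P x 2) 2} : Multiset T) := by simp [h]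
      rcases (by simpa using this : P y 2 = X.e ∨ P y 2 = P (P x 2) 2) with h | h <;> tauto
    · rw [hax] at h
      tauto
  rcases hcases with h | h | h
  · rw [h, X.mul_e] at hr
    have : P x 2 ∈ ({r, r} : Multiset T) := by simp [← hr]
    exact ⟨x, (by simpa using this : P x 2 = r).symm⟩
  · obtain ⟨-, h1, -, hk⟩ := hP (P x 2)
    have := hk 2 (by norm_num)
    have hx : P x 2 ∈ ({r, r} : Multiset T) := by
      rw [← hr, h, this]
      simp [h1]
    exact ⟨x, (by simpa using hx : P x 2 = r).symm⟩
  · have he : X.e ∈ ({r, r} : Multiset T) := by simp [← hr, h, hP.mul_self]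
    exact ⟨X.e, by rw [hP.e_pow_two]; exact (by simpa using he : X.e = r).symm⟩

end

/-- **Lemma 6.4 (lem_squares).** In an involutive commutative two-valued group, the set
`Q = {x² : x ∈ X}` of squares is a subgroup: for any `x, y`, both elements of the
multiset `x² * y²` are squares. Here `P` is the (unique) family of integer power
sequences, so `x² = P x 2`. -/
theorem squares_isSubgroup {T : Type u} (X : TwoValuedGroup T)
    (hc : X.Commutative) (hinv : X.Involutive)
    (P : T → ℤ → T) (hP : X.IsPowFamily P) (x y : T) :
    ∀ z ∈ X.mul (P x 2) (P y 2), ∃ w : T, z = P w 2 := by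
  intro z hz
  obtain ⟨a, b, hab⟩ := X.exists_mul_eq_pair x y
  obtain ⟨r, s, hrs⟩ := X.exists_mul_eq_pair (P x 2) (P y 2)
  rw [hrs] at hz
  rcases hP.sq_mul_sq hc hab hrs with h | ⟨rfl, -, h⟩
  · rw [h] at hz
    rcases (by simpa using hz : z = P a 2 ∨ z = P b 2) with rfl | rfl
    exacts [⟨a, rfl⟩, ⟨b, rfl⟩]
  · obtain rfl : z = r := by simpa using hz
    rcases h with h | h | h
    · exact hP.exists_eq_sq hc hinv hab hrs h
    · exact hP.exists_eq_sq hc hinv ((hc y x).trans hab) ((hc _ _).trans hrs) h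
    · exact ⟨a, h.symm⟩

end TwoValuedGroup
end
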